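/- There is an absolute constant C such that for every prime p and all integers b₁, b₂, b₃, b₄ coprime to p with the property that some bᵢ is not congruent modulo p to any b_j with j ≠ i, one has |G_p(b₁,b₂,b₃,b₄)| ≤ C p^{5/2}. -/

import Mathlib

/-- `e_q(x) = exp(2πi x / q)`. -/
noncomputable def eInt (q : ℕ) (x : ℤ) : ℂ := Complex.exp (2 * Real.pi * Complex.I * x / q)

/-- A natural-number representative of the multiplicative inverse of `x` modulo `q`. -/
noncomputable def invMod (q : ℕ) (x : ℤ) : ℕ := (((x : ZMod q))⁻¹).val

/-- The Kloosterman sum `S(a,b;q) = ∑_{x mod q, (x,q)=1} e_q(a x + b x̄)`. -/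
noncomputable def Kloos (q : ℕ) (a b : ℤ) : ℂ :=
  ∑ x ∈ (Finset.range q).filter (fun x => Nat.Coprime x q), eInt q (a * x + b * invMod q x)

/-- `G_q(b₁,b₂,b₃,b₄) = ∑_{h mod q} S(h,b̄₁;q) S(h,b̄₂;q) S(h,b̄₃;q) S(h,b̄₄;q)`. -/
noncomputable def Gquad (q : ℕ) (b₁ b₂ b₃ b₄ : ℤ) : ℂ :=
  ∑ h ∈ Finset.range q,
    Kloos q h (invMod q b₁) * Kloos q h (invMod q b₂) *
      Kloos q h (invMod q b₃) * Kloos q h (invMod q b₄)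

open Polynomial

/-- The first-order operator `u ↦ e f' u + f u'`. -/
noncomputable def weightedDeriv {F : Type*} [Field F] (f : F[X]) (e : F) : F[X] →ₗ[F] F[X] :=
  LinearMap.mulLeft F (C e * derivative f) + LinearMap.mulLeft F f ∘ₗ derivative

/-- The composite of the operators `weightedDeriv f e`, …, `weightedDeriv f (e - k + 1)`. -/
noncomputable def weightedDerivIter {F : Type*} [Field F] (f : F[X]) (e : F) :
    ℕ → F[X] →ₗ[F] F[X]
  | 0 => LinearMap.id
  | k + 1 => weightedDeriv f (e - k) ∘ₗ weightedDerivIter f e k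

theorem iterate_derivative_pow_mul {F : Type*} [Field F] (f G u : F[X]) (e : F)
    (hG : f * derivative G = C e * derivative f * G) (L k : ℕ) (hk : k ≤ L) :
    derivative^[k] (f ^ L * u * G) =
      f ^ (L - k) * weightedDerivIter f (L + e) k u * G := by
  induction k with
  | zero => simp [weightedDerivIter]
  | succ k ih =>
    obtain ⟨m, rfl⟩ : ∃ m, L = k + 1 + m := ⟨L - (k + 1), by omega⟩
    rw [Function.iterate_succ_apply', ih (by omega)]
    have h1 : k + 1 + m - k = m + 1 := by omega
    have h2 : k + 1 + m - (k + 1) = m := by omega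
    rw [h1, h2]
    simp only [weightedDerivIter, weightedDeriv, LinearMap.comp_apply, LinearMap.add_apply,
      LinearMap.mulLeft_apply]
    generalize weightedDerivIter f _ k u = v
    have h3 : (((k + 1 + m : ℕ) : F) + e - k) = (m + 1 : ℕ) + e := by push_cast; ring
    rw [h3]
    simp only [derivative_mul, derivative_pow, map_add, map_natCast]
    have h4 : m + 1 - 1 = m := by omega
    rw [h4]
    linear_combination f ^ m * v * hG

theorem degree_weightedDerivIter_lt {F : Type*} [Field F] (f : F[X]) (e : F) {m : ℕ}
    (hf : f.natDegree ≤ m + 1) {u : F[X]} {d : ℕ} (hu : u.degree < d) (k : ℕ) :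
    (weightedDerivIter f e k u).degree < (d + m * k : ℕ) := by
  induction k with
  | zero => simpa [weightedDerivIter] using hu
  | succ k ih =>
    simp only [weightedDerivIter, weightedDeriv, LinearMap.comp_apply, LinearMap.add_apply,
      LinearMap.mulLeft_apply]
    generalize weightedDerivIter f _ k u = v at *
    generalize e - (k : F) = e'
    by_cases hv : v = 0
    · subst hv
      simp only [derivative_zero, mul_zero, add_zero, degree_zero]
      exact WithBot.bot_lt_coe _
    have hv' : v.natDegree < d + m * k := (natDegree_lt_iff_degree_lt hv).2 ih
    have hf' : (derivative f).natDegree ≤ m := (natDegree_derivative_le f).trans (by omega)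
    refine (degree_add_le _ _).trans_lt (max_lt ?_ ?_)
    · refine degree_le_natDegree.trans_lt ?_
      have h1 := natDegree_mul_le (p := C e' * derivative f) (q := v)
      have h2 := natDegree_C_mul_le e' (derivative f)
      have : m * (k + 1) = m * k + m := by ring
      exact_mod_cast (by omega)
    · by_cases hv0 : derivative v = 0
      · rw [hv0, mul_zero, degree_zero]; exact WithBot.bot_lt_coe _
      have h4 : v.natDegree ≠ 0 := by
        intro h
        exact hv0 (derivative_of_natDegree_zero h)
      refine degree_le_natDegree.trans_lt ?_
      have h1 := natDegree_mul_le (p := f) (q := derivative v)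
      have h2 := natDegree_derivative_lt h4
      have : m * (k + 1) = m * k + m := by ring
      exact_mod_cast (by omega)

theorem exists_stepanov_coeffs {F : Type*} [Field F] (f : F[X]) (a e₁ e₂ : F) {m : ℕ}
    (hf : f.natDegree ≤ m + 1) {d J L : ℕ} (h : L * (d + m * L + J) < 2 * J * d) :
    ∃ r s : Fin J → F[X], (∀ j, (r j).degree < d) ∧ (∀ j, (s j).degree < d) ∧
      (∃ j, r j ≠ 0 ∨ s j ≠ 0) ∧
      ∀ k < L, ∑ j : Fin J, X ^ (j : ℕ) *
        (weightedDerivIter f e₁ k (r j) + C a * weightedDerivIter f e₂ k (s j)) = 0 := by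
  classical
  let V := Fin J → (degreeLT F d × degreeLT F d)
  let T (k : ℕ) : V →ₗ[F] F[X] := ∑ j : Fin J, LinearMap.mulLeft F (X ^ (j : ℕ)) ∘ₗ
    (weightedDerivIter f e₁ k ∘ₗ (degreeLT F d).subtype ∘ₗ LinearMap.fst F _ _ +
      LinearMap.mulLeft F (C a) ∘ₗ weightedDerivIter f e₂ k ∘ₗ (degreeLT F d).subtype ∘ₗ
        LinearMap.snd F _ _) ∘ₗ LinearMap.proj j
  have hT (k : ℕ) (v : V) : T k v = ∑ j : Fin J, X ^ (j : ℕ) *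
        (weightedDerivIter f e₁ k (v j).1 + C a * weightedDerivIter f e₂ k (v j).2) := by
    simp [T, LinearMap.sum_apply]
    rfl
  let Φ : V →ₗ[F] (Fin L → Fin (d + m * L + J) → F) :=
    LinearMap.pi fun k => LinearMap.pi fun i => lcoeff F i ∘ₗ T k
  have hdim : Module.finrank F (Fin L → Fin (d + m * L + J) → F) < Module.finrank F V := by
    have e := (degreeLTEquiv F d).finrank_eq
    simp only [V, Module.finrank_pi_fintype, Module.finrank_prod, e, Module.finrank_self,
      Finset.sum_const, Finset.card_univ, Fintype.card_fin, smul_eq_mul, mul_one]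
    linarith
  have : Module.Finite F (degreeLT F d) := Module.Finite.equiv (degreeLTEquiv F d).symm
  obtain ⟨v, hv, hv0⟩ := (Submodule.ne_bot_iff _).1 (Φ.ker_ne_bot_of_finrank_lt hdim)
  refine ⟨fun j => (v j).1, fun j => (v j).2, fun j => mem_degreeLT.1 (v j).1.2,
    fun j => mem_degreeLT.1 (v j).2.2, ?_, fun k hk => ?_⟩
  · by_contra! hc
    refine hv0 (funext fun j => Prod.ext (Subtype.ext ?_) (Subtype.ext ?_))
    · exact (hc j).1
    · exact (hc j).2
  · rw [← hT]
    ext i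
    by_cases hi : i < d + m * L + J
    · exact congrFun (congrFun (LinearMap.mem_ker.1 hv) ⟨k, hk⟩) ⟨i, hi⟩
    · rw [coeff_zero, hT]
      refine coeff_eq_zero_of_degree_lt (lt_of_lt_of_le ?_ (Nat.cast_le.2 (not_lt.1 hi)))
      refine (degree_sum_le _ _).trans_lt ?_
      rw [Finset.sup_lt_iff (WithBot.bot_lt_coe _)]
      intro j _
      have hmk : m * k ≤ m * L := Nat.mul_le_mul_left m hk.le
      have hA := degree_weightedDerivIter_lt f e₁ hf (mem_degreeLT.1 (v j).1.2) k
      have hB := degree_weightedDerivIter_lt f e₂ hf (mem_degreeLT.1 (v j).2.2) k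
      have hB' : (C a * weightedDerivIter f e₂ k ((v j).2 : F[X])).degree < (d + m * k : ℕ) := by
        rw [← smul_eq_C_mul]
        exact (degree_smul_le _ _).trans_lt hB
      have hAB := (degree_add_le _ _).trans_lt (max_lt hA hB')
      generalize weightedDerivIter f e₁ k ((v j).1 : F[X]) +
        C a * weightedDerivIter f e₂ k ((v j).2 : F[X]) = w at *
      by_cases hw : w = 0
      · rw [hw, mul_zero, degree_zero]; exact WithBot.bot_lt_coe _
      have := (natDegree_lt_iff_degree_lt hw).2 hAB
      refine degree_le_natDegree.trans_lt ?_
      rw [natDegree_X_pow_mul _ hw]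
      have := j.2
      exact_mod_cast (by omega)

theorem isSquare_of_mul_sq_eq {F : Type*} [Field F] {f r s : F[X]} (hf : f.Monic) {c : F}
    (hc : c ≠ 0) (h : f * r ^ 2 = C c * s ^ 2) (hs : s ≠ 0) : IsSquare f := by
  have hr : r ≠ 0 := by
    rintro rfl
    simp [hc, hs] at h
  have hlc := congrArg leadingCoeff h
  simp only [leadingCoeff_mul, leadingCoeff_pow, leadingCoeff_C, hf.leadingCoeff, one_mul] at hlc
  set e := r.leadingCoeff / s.leadingCoeff with he
  have hls : s.leadingCoeff ≠ 0 := leadingCoeff_ne_zero.2 hs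
  have hce : c = e ^ 2 := by
    rw [he, div_pow, hlc]; field_simp
  have h2 : f * r ^ 2 = (C e * s) ^ 2 := by rw [h, hce, mul_pow, C_pow]
  have hdvd : r ∣ C e * s := (UniqueFactorizationMonoid.pow_dvd_pow_iff_dvd two_ne_zero).1
    (Dvd.intro_left f h2)
  obtain ⟨t, ht⟩ := hdvd
  refine ⟨t, mul_right_cancel₀ (pow_ne_zero 2 hr) ?_⟩
  rw [h2, ht]; ring

theorem stepanov_poly_ne_zero {p : ℕ} [Fact p.Prime] (hp : p ≠ 2) {f : (ZMod p)[X]}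
    (hf : f.Monic) (hsq : ¬ IsSquare f) (hf0 : f.eval 0 ≠ 0) {d J : ℕ}
    (hd : 2 * d + f.natDegree ≤ p + 1)
    (r s : Fin J → (ZMod p)[X]) (hr : ∀ j, (r j).degree < d) (hs : ∀ j, (s j).degree < d)
    (hrs : ∃ j, r j ≠ 0 ∨ s j ≠ 0) :
    ∑ j, (r j + s j * f ^ ((p - 1) / 2)) * X ^ (p * (j : ℕ)) ≠ 0 := by
  classical
  intro h0
  obtain ⟨k, hk, hmin⟩ := WellFounded.has_min (wellFounded_lt (α := Fin J))
    {j | r j ≠ 0 ∨ s j ≠ 0} hrs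
  have hlt (j : Fin J) (hj : j < k) : r j = 0 ∧ s j = 0 := by
    by_contra hc
    exact hmin j (by simp only [Set.mem_ofPred_eq]; tauto) hj
  have hp1 := (Fact.out : p.Prime).one_lt
  have hdvd : X ^ p ∣ r k + s k * f ^ ((p - 1) / 2) := by
    have h1 : X ^ (p * (k : ℕ)) * X ^ p ∣
        (r k + s k * f ^ ((p - 1) / 2)) * X ^ (p * (k : ℕ)) := by
      rw [← Finset.add_sum_erase _ _ (Finset.mem_univ k)] at h0
      rw [eq_neg_of_add_eq_zero_left h0, dvd_neg]
      refine Finset.dvd_sum fun j hj => ?_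
      rcases lt_trichotomy j k with hjk | hjk | hjk
      · simp [hlt j hjk]
      · exact absurd hjk (Finset.ne_of_mem_erase hj)
      · refine Dvd.dvd.mul_left ?_ _
        rw [← pow_add]
        refine pow_dvd_pow _ ?_
        have : (k : ℕ) + 1 ≤ j := hjk
        nlinarith
    rw [mul_comm] at h1
    exact (mul_dvd_mul_iff_right (pow_ne_zero _ X_ne_zero)).1 h1
  have hodd : 1 + 2 * ((p - 1) / 2) = p := by
    rcases (Fact.out : p.Prime).eq_two_or_odd with h | h <;> omega
  set g := f ^ ((p - 1) / 2) with hg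
  have hfp : f * g ^ 2 = f ^ p := by
    rw [hg, ← pow_mul, ← pow_succ', mul_comm, add_comm, hodd]
  have hXp : X ^ p ∣ f ^ p - C (f.eval 0) := by
    have h1 : X ∣ f - C (f.eval 0) := by
      rw [X_dvd_iff, coeff_sub, coeff_C_zero, coeff_zero_eq_eval_zero, sub_self]
    have h2 := pow_dvd_pow_of_dvd h1 p
    rwa [sub_pow_char, ← C_pow, ZMod.pow_card] at h2
  have hdvd2 : X ^ p ∣ f * r k ^ 2 - C (f.eval 0) * s k ^ 2 := by
    have : f * r k ^ 2 - C (f.eval 0) * s k ^ 2 =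
        (r k + s k * g) * (f * (r k - s k * g)) + (f ^ p - C (f.eval 0)) * s k ^ 2 := by
      linear_combination (s k) ^ 2 * hfp
    rw [this]
    exact dvd_add (hdvd.mul_right _) (hXp.mul_right _)
  have hzero : f * r k ^ 2 - C (f.eval 0) * s k ^ 2 = 0 := by
    have key (u v : (ZMod p)[X]) (hu : u.natDegree ≤ f.natDegree) (hv : v.degree < d) :
        (u * v ^ 2).degree < p := by
      by_cases hv0 : v = 0
      · simp [hv0]
      have h1 := (natDegree_lt_iff_degree_lt hv0).2 hv
      have h2 := natDegree_mul_le (p := u) (q := v ^ 2)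
      rw [natDegree_pow] at h2
      refine degree_le_natDegree.trans_lt ?_
      exact_mod_cast (by omega)
    refine eq_zero_of_dvd_of_degree_lt hdvd2 ?_
    rw [degree_X_pow]
    exact (degree_sub_le _ _).trans_lt
      (max_lt (key _ _ le_rfl (hr k)) (key _ _ (by simp) (hs k)))
  have hzero' := sub_eq_zero.1 hzero
  by_cases hs0 : s k = 0
  · have hr0 : r k = 0 := by simpa [hs0, hf.ne_zero] using hzero'
    rcases hk with h | h
    · exact h hr0
    · exact h hs0
  · exact hsq (isSquare_of_mul_sq_eq hf hf0 hzero' hs0)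

theorem mul_card_le_natDegree_of_iterate_derivative {p : ℕ} [Fact p.Prime] {P : (ZMod p)[X]}
    (hP : P ≠ 0) {L : ℕ} (hL : L ≤ p) (S : Finset (ZMod p))
    (hS : ∀ x ∈ S, ∀ k < L, (derivative^[k] P).eval x = 0) : L * S.card ≤ P.natDegree := by
  classical
  rcases Nat.eq_zero_or_pos L with rfl | hL0
  · simp
  refine le_trans ?_ (card_roots' P)
  have : L • S.val ≤ P.roots := by
    rw [Multiset.le_iff_count]
    intro x
    rw [Multiset.count_nsmul, count_roots]
    by_cases hx : x ∈ S
    · rw [Multiset.count_eq_one_of_mem S.nodup hx, mul_one]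
      have := lt_rootMultiplicity_of_isRoot_iterate_derivative_of_mem_nonZeroDivisors
        (n := L - 1) (t := x) hP (fun m hm => hS x hx m (by omega)) ?_
      · omega
      · refine mem_nonZeroDivisors_of_ne_zero ?_
        rw [Ne, ZMod.natCast_eq_zero_iff, (Fact.out : p.Prime).dvd_factorial]
        omega
    · rw [Multiset.count_eq_zero_of_notMem hx]
      simp
  simpa using Multiset.card_le_card this

theorem stepanov_card_le {p : ℕ} [Fact p.Prime] (hp : p ≠ 2) {f : (ZMod p)[X]}
    (hf : f.Monic) (hsq : ¬ IsSquare f) (hf0 : f.eval 0 ≠ 0) {m : ℕ}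
    (hm : f.natDegree = m + 1) (a : ZMod p) {d J L : ℕ}
    (hd : 2 * d + (m + 1) ≤ p + 1) (hLp : L ≤ p) (hdJL : L * (d + m * L + J) < 2 * J * d) :
    L * (Finset.univ.filter fun x => f.eval x ^ ((p - 1) / 2) = a).card ≤
      (m + 1) * L + d + (m + 1) * ((p - 1) / 2) + p * (J - 1) := by
  classical
  set n := (p - 1) / 2 with hn
  obtain ⟨r, s, hr, hs, hrs, hsum⟩ := exists_stepanov_coeffs f a (L : ZMod p) (L + n) hm.le hdJL
  set P : (ZMod p)[X] := f ^ L * ∑ j, (r j + s j * f ^ n) * X ^ (p * (j : ℕ)) with hP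
  have hP0 : P ≠ 0 := mul_ne_zero (pow_ne_zero _ hf.ne_zero)
    (stepanov_poly_ne_zero hp hf hsq hf0 (by omega) r s hr hs hrs)
  have hPsum : P = ∑ j, (f ^ L * r j * X ^ (p * (j : ℕ)) +
      f ^ L * s j * (f ^ n * X ^ (p * (j : ℕ)))) := by
    rw [hP, Finset.mul_sum]
    exact Finset.sum_congr rfl fun j _ => by ring
  refine (mul_card_le_natDegree_of_iterate_derivative hP0 hLp _ ?_).trans ?_
  · intro x hx k hk
    rw [Finset.mem_filter] at hx
    have hD (j : ℕ) : derivative (X ^ (p * j) : (ZMod p)[X]) = 0 := by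
      rw [derivative_X_pow]; simp
    have h1 (j : Fin J) : derivative^[k] (f ^ L * r j * X ^ (p * (j : ℕ))) =
        f ^ (L - k) * weightedDerivIter f L k (r j) * X ^ (p * (j : ℕ)) := by
      have := iterate_derivative_pow_mul f (X ^ (p * (j : ℕ))) (r j) 0 (by simp [hD]) L k hk.le
      rwa [add_zero] at this
    have h2 (j : Fin J) : derivative^[k] (f ^ L * s j * (f ^ n * X ^ (p * (j : ℕ)))) =
        f ^ (L - k) * weightedDerivIter f (L + n) k (s j) * (f ^ n * X ^ (p * (j : ℕ))) := by
      refine iterate_derivative_pow_mul f _ (s j) (n : ZMod p) ?_ L k hk.le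
      rw [derivative_mul, hD, derivative_pow]
      rcases Nat.eq_zero_or_pos n with h | h
      · simp [h]
      · obtain ⟨n', hn'⟩ := Nat.exists_eq_succ_of_ne_zero h.ne'
        rw [hn']
        simp only [Nat.succ_eq_add_one, Nat.add_sub_cancel]
        rw [pow_succ]
        ring
    rw [hPsum, iterate_derivative_sum, eval_finsetSum]
    have h3 := congrArg (eval x) (hsum k hk)
    rw [eval_finsetSum, eval_zero] at h3
    rw [← mul_zero (f.eval x ^ (L - k)), ← h3, Finset.mul_sum]
    refine Finset.sum_congr rfl fun j _ => ?_
    rw [iterate_map_add, h1, h2]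
    simp only [eval_add, eval_mul, eval_pow, eval_X, eval_C, hx.2, pow_mul, ZMod.pow_card]
    ring
  · rw [hP]
    refine natDegree_mul_le.trans ?_
    have hfL : (f ^ L).natDegree = (m + 1) * L := by rw [natDegree_pow, hm, mul_comm]
    have hfn : (f ^ n).natDegree = (m + 1) * n := by rw [natDegree_pow, hm, mul_comm]
    rw [hfL, add_assoc, add_assoc]
    refine Nat.add_le_add_left (natDegree_sum_le_of_forall_le _ _ fun j _ => ?_) _
    refine natDegree_mul_le.trans ?_
    rw [natDegree_X_pow, ← add_assoc]
    have hj : (j : ℕ) ≤ J - 1 := by have := j.2; omega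
    refine Nat.add_le_add ?_ (Nat.mul_le_mul_left p hj)
    have hdeg (u : (ZMod p)[X]) (hu : u.degree < d) : u.natDegree ≤ d :=
      natDegree_le_of_degree_le hu.le
    refine (natDegree_add_le _ _).trans (max_le ((hdeg _ (hr j)).trans (by omega)) ?_)
    refine natDegree_mul_le.trans ?_
    rw [hfn]
    exact Nat.add_le_add_right (hdeg _ (hs j)) _

theorem two_mul_card_quartic_pow_eq_le {p : ℕ} [Fact p.Prime] (hp : 64 ≤ p) {f : (ZMod p)[X]}
    (hf : f.Monic) (hsq : ¬ IsSquare f) (hf0 : f.eval 0 ≠ 0) (hm : f.natDegree = 4)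
    (a : ZMod p) :
    2 * (Finset.univ.filter fun x => f.eval x ^ ((p - 1) / 2) = a).card ≤
      p + 13 * Nat.sqrt p + 34 := by
  have hpodd : p % 2 = 1 := (Fact.out : p.Prime).eq_two_or_odd.resolve_left (by omega)
  obtain ⟨d, hd⟩ : ∃ d, p = 2 * d + 3 := ⟨(p - 3) / 2, by omega⟩
  have hL1 := Nat.sqrt_le' p
  have hL2 := Nat.lt_succ_sqrt' p
  have hL8 : 8 ≤ Nat.sqrt p := Nat.le_sqrt'.2 (by omega)
  set L := Nat.sqrt p with hL
  have hJ1 : L + 9 ≤ 2 * (L / 2 + 5) := by omega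
  have hJ2 : 2 * (L / 2 + 5) ≤ L + 10 := by omega
  set J := L / 2 + 5 with hJ
  have key := stepanov_card_le (p := p) (by omega) hf hsq hf0 (m := 3) hm a (d := d) (J := J)
    (L := L) (by omega) (Nat.sqrt_le_self p) (by
      have h1 : 7 * L ^ 2 + 10 * L < 18 * d := by nlinarith
      have h2 : L * (2 * J) ≤ L * (L + 10) := Nat.mul_le_mul_left _ hJ2
      have h3 : d * (L + 9) ≤ d * (2 * J) := Nat.mul_le_mul_left _ hJ1
      nlinarith)
  generalize (Finset.univ.filter fun x => f.eval x ^ ((p - 1) / 2) = a).card = N at key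
  have h4 : 4 * ((p - 1) / 2) ≤ 2 * p := by omega
  have h5 : p * (2 * (J - 1)) ≤ p * (L + 8) := Nat.mul_le_mul_left _ (by omega)
  have h6 : p ≤ L ^ 2 + 2 * L := by
    have : L.succ ^ 2 = L ^ 2 + 2 * L + 1 := by rw [Nat.succ_eq_add_one]; ring
    omega
  have h7 : L * (2 * N) ≤ L * (p + 13 * L + 34) := by nlinarith
  exact Nat.le_of_mul_le_mul_left h7 (by omega)

theorem quadraticChar_eq_ite_pow {p : ℕ} [Fact p.Prime] (hp : p ≠ 2) (y : ZMod p) :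
    quadraticChar (ZMod p) y =
      (if y ^ ((p - 1) / 2) = 1 then 1 else 0) - (if y ^ ((p - 1) / 2) = -1 then 1 else 0) := by
  have hodd : p % 2 = 1 := (Fact.out : p.Prime).eq_two_or_odd.resolve_left hp
  have h2 : ringChar (ZMod p) ≠ 2 := by rwa [ZMod.ringChar_zmod_n]
  have : Fact (2 < p) := ⟨lt_of_le_of_ne (Fact.out : p.Prime).two_le hp.symm⟩
  have hne : (-1 : ZMod p) ≠ 1 := ZMod.neg_one_ne_one
  have hdiv : Fintype.card (ZMod p) / 2 = (p - 1) / 2 := by rw [ZMod.card]; omega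
  have h := quadraticChar_eq_pow_of_char_ne_two' h2 y
  rw [hdiv] at h
  rw [← h]
  by_cases hy : y = 0
  · subst hy; simp
  rcases quadraticChar_dichotomy hy with hy1 | hy1
  · simp [hy1, hne.symm]
  · simp [hy1, hne]

theorem abs_sum_quadraticChar_quartic_le_of_eval_zero_ne {p : ℕ} [Fact p.Prime] (hp : 64 ≤ p)
    {f : (ZMod p)[X]} (hf : f.Monic) (hsq : ¬ IsSquare f) (hm : f.natDegree = 4)
    (hf0 : f.eval 0 ≠ 0) :
    |∑ x, quadraticChar (ZMod p) (f.eval x)| ≤ 13 * (Nat.sqrt p : ℤ) + 38 := by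
  classical
  have hp2 : p ≠ 2 := by omega
  have : Fact (2 < p) := ⟨by omega⟩
  have hne : (-1 : ZMod p) ≠ 1 := ZMod.neg_one_ne_one
  have h1 := two_mul_card_quartic_pow_eq_le hp hf hsq hf0 hm 1
  have h2 := two_mul_card_quartic_pow_eq_le hp hf hsq hf0 hm (-1)
  have hsum : ∑ x, quadraticChar (ZMod p) (f.eval x) =
      ((Finset.univ.filter fun x => f.eval x ^ ((p - 1) / 2) = 1).card : ℤ) -
      (Finset.univ.filter fun x => f.eval x ^ ((p - 1) / 2) = -1).card := by
    simp only [quadraticChar_eq_ite_pow hp2, Finset.sum_sub_distrib, Finset.sum_boole]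
  have hcover : p ≤ (Finset.univ.filter fun x => f.eval x ^ ((p - 1) / 2) = 1).card +
      (Finset.univ.filter fun x => f.eval x ^ ((p - 1) / 2) = -1).card + 4 := by
    have hsub : (Finset.univ : Finset (ZMod p)) ⊆
        ((Finset.univ.filter fun x => f.eval x ^ ((p - 1) / 2) = 1) ∪
        (Finset.univ.filter fun x => f.eval x ^ ((p - 1) / 2) = -1)) ∪ f.roots.toFinset := by
      intro x _
      have hodd : p % 2 = 1 := (Fact.out : p.Prime).eq_two_or_odd.resolve_left hp2
      have hdiv : p / 2 = (p - 1) / 2 := by omega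
      simp only [Finset.mem_union, Finset.mem_filter, Finset.mem_univ, true_and,
        Multiset.mem_toFinset, mem_roots hf.ne_zero, IsRoot]
      by_cases hx : f.eval x = 0
      · exact Or.inr hx
      · have := ZMod.pow_div_two_eq_neg_one_or_one p hx
        rw [hdiv] at this
        exact Or.inl this
    have := Finset.card_le_card hsub
    rw [Finset.card_univ, ZMod.card] at this
    refine this.trans ((Finset.card_union_le _ _).trans (Nat.add_le_add
      (Finset.card_union_le _ _) ?_))
    exact (Multiset.toFinset_card_le _).trans ((card_roots' f).trans hm.le)
  rw [hsum, abs_le]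
  omega

/-- Weil's bound for quartic character sums over a prime field, up to the constant. -/
theorem abs_sum_quadraticChar_quartic_le {p : ℕ} [Fact p.Prime] (hp : 64 ≤ p)
    {f : (ZMod p)[X]} (hf : f.Monic) (hsq : ¬ IsSquare f) (hm : f.natDegree = 4) :
    |∑ x, quadraticChar (ZMod p) (f.eval x)| ≤ 13 * (Nat.sqrt p : ℤ) + 38 := by
  classical
  obtain ⟨a, ha⟩ : ∃ a, f.eval a ≠ 0 := by
    by_contra! hc
    refine hf.ne_zero (eq_zero_of_natDegree_lt_card_of_eval_eq_zero' f Finset.univ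
      (fun x _ => hc x) ?_)
    rw [Finset.card_univ, ZMod.card]; omega
  have hcomp : (f.comp (X + C a)).comp (X - C a) = f := by
    rw [comp_assoc]; simp
  have hsq' : ¬ IsSquare (f.comp (X + C a)) := by
    rintro ⟨h, hh⟩
    exact hsq ⟨h.comp (X - C a), by rw [← mul_comp, ← hh, hcomp]⟩
  have := abs_sum_quadraticChar_quartic_le_of_eval_zero_ne hp (hf.comp_X_add_C a) hsq'
    (by rw [natDegree_comp, natDegree_X_add_C, mul_one, hm]) (by simpa using ha)
  rwa [show ∑ x, quadraticChar (ZMod p) ((f.comp (X + C a)).eval x) =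
    ∑ x, quadraticChar (ZMod p) (f.eval x) from
      Fintype.sum_equiv (Equiv.addRight a) _ _ (by intro x; simp)] at this

/-- The discriminant of `t u² + (b - a - t) u + a`, as a polynomial in `t`. -/
noncomputable def discPoly {F : Type*} [Field F] (a b : F) : F[X] :=
  (X - C (a + b)) ^ 2 - C (4 * (a * b))

theorem eval_discPoly {F : Type*} [Field F] (a b t : F) :
    (discPoly a b).eval t = (t - (a + b)) ^ 2 - 4 * (a * b) := by
  simp [discPoly]

theorem natDegree_discPoly {F : Type*} [Field F] (a b : F) : (discPoly a b).natDegree = 2 := by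
  rw [discPoly, natDegree_sub_C, natDegree_pow, natDegree_X_sub_C]

theorem monic_discPoly {F : Type*} [Field F] (a b : F) : (discPoly a b).Monic := by
  refine ((monic_X_sub_C (a + b)).pow 2).sub_of_left (degree_C_le.trans_lt ?_)
  rw [degree_pow, degree_X_sub_C]
  norm_num

theorem squarefree_discPoly {F : Type*} [Field F] (h2 : (2 : F) ≠ 0) {a b : F} (ha : a ≠ 0)
    (hb : b ≠ 0) : Squarefree (discPoly a b) := by
  refine Separable.squarefree ?_
  have hδ : 4 * (a * b) ≠ 0 := by
    have : (4 : F) = 2 * 2 := by norm_num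
    rw [this]
    exact mul_ne_zero (mul_ne_zero h2 h2) (mul_ne_zero ha hb)
  refine ⟨-C (4 * (a * b))⁻¹, C ((4 * (a * b))⁻¹ * 2⁻¹) * (X - C (a + b)), ?_⟩
  have hd : derivative (discPoly a b) = C 2 * (X - C (a + b)) := by
    simp only [discPoly, derivative_sub, derivative_X_sub_C_sq, derivative_C, sub_zero]
  have h3 : C (4 * (a * b))⁻¹ * C (4 * (a * b)) = 1 := by
    rw [← C_mul, inv_mul_cancel₀ hδ, C_1]
  have h4 : C (2⁻¹ : F) * C 2 = 1 := by rw [← C_mul, inv_mul_cancel₀ h2, C_1]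
  rw [hd, discPoly, C_mul (a := (4 * (a * b))⁻¹) (b := 2⁻¹)]
  linear_combination h3 + C (4 * (a * b))⁻¹ * (X - C (a + b)) ^ 2 * h4

theorem discPoly_injective {F : Type*} [Field F] (h2 : (2 : F) ≠ 0) {a b c d : F}
    (h : discPoly a b = discPoly c d) : (a = c ∧ b = d) ∨ (a = d ∧ b = c) := by
  have h4 : (4 : F) ≠ 0 := by
    have : (4 : F) = 2 * 2 := by norm_num
    rw [this]
    exact mul_ne_zero h2 h2
  have e0 := congrArg (eval 0) h
  have e1 := congrArg (eval 1) h
  rw [eval_discPoly, eval_discPoly] at e0 e1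
  have hs : a + b = c + d := mul_left_cancel₀ h2 (by linear_combination e0 - e1)
  have hp : a * b = c * d := mul_left_cancel₀ h4 (by
    linear_combination (a + b + c + d) * hs - e0)
  have : (a - c) * (a - d) = 0 := by linear_combination a * hs - hp
  rcases mul_eq_zero.1 this with h | h
  · exact Or.inl ⟨sub_eq_zero.1 h, by linear_combination hs - h⟩
  · exact Or.inr ⟨sub_eq_zero.1 h, by linear_combination hs - h⟩

theorem not_isSquare_discPoly_mul {F : Type*} [Field F] (h2 : (2 : F) ≠ 0) {a b c d : F}
    (ha : a ≠ 0) (hb : b ≠ 0) (hc : c ≠ 0) (hd : d ≠ 0)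
    (h : ¬ ((a = c ∧ b = d) ∨ (a = d ∧ b = c))) : ¬ IsSquare (discPoly a b * discPoly c d) := by
  rintro ⟨g, hg⟩
  have hg0 : g ≠ 0 := by
    rintro rfl
    rw [mul_zero] at hg
    exact mul_ne_zero (monic_discPoly a b).ne_zero (monic_discPoly c d).ne_zero hg
  have hdeg : g.natDegree = 2 := by
    have := congrArg natDegree hg
    rw [natDegree_mul hg0 hg0, (monic_discPoly a b).natDegree_mul (monic_discPoly c d),
      natDegree_discPoly, natDegree_discPoly] at this
    omega
  have key (x y : F) (hx : x ≠ 0) (hy : y ≠ 0) (hdvd : discPoly x y ∣ g * g) :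
      g = C g.leadingCoeff * discPoly x y := by
    rw [← sq, (squarefree_discPoly h2 hx hy).dvd_pow_iff_dvd two_ne_zero] at hdvd
    exact eq_leadingCoeff_mul_of_monic_of_dvd_of_natDegree_le (monic_discPoly x y) hdvd
      (by rw [hdeg, natDegree_discPoly])
  have h1 := key a b ha hb (hg ▸ dvd_mul_right _ _)
  have h3 := key c d hc hd (hg ▸ dvd_mul_left _ _)
  refine h (discPoly_injective h2 (mul_left_cancel₀ ?_ (h1.symm.trans h3)))
  rwa [Ne, C_eq_zero, leadingCoeff_eq_zero]

/-- The number of `u ≠ 0, 1` with `a / u + b / (1 - u) = t`. -/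
def fiberCount {F : Type*} [Field F] [Fintype F] [DecidableEq F] (a b t : F) : ℕ :=
  (Finset.univ.filter fun u : F => u ≠ 0 ∧ u ≠ 1 ∧ a / u + b / (1 - u) = t).card

theorem div_add_div_one_sub_eq_iff {F : Type*} [Field F] {a b t u : F} (h0 : u ≠ 0)
    (h1 : u ≠ 1) : a / u + b / (1 - u) = t ↔ t * u ^ 2 + (b - a - t) * u + a = 0 := by
  have h1' : 1 - u ≠ 0 := sub_ne_zero.2 h1.symm
  rw [div_add_div _ _ h0 h1', div_eq_iff (mul_ne_zero h0 h1'), ← sub_eq_zero]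
  constructor <;> intro h <;> linear_combination h

theorem fiberCount_eq {F : Type*} [Field F] [Fintype F] [DecidableEq F] (h2 : ringChar F ≠ 2)
    {a b t : F} (ha : a ≠ 0) (hb : b ≠ 0) (ht : t ≠ 0) :
    (fiberCount a b t : ℤ) = quadraticChar F ((discPoly a b).eval t) + 1 := by
  have h2' : (2 : F) ≠ 0 := Ring.two_ne_zero h2
  rw [← quadraticChar_card_sqrts h2, eval_discPoly, fiberCount]
  norm_cast
  refine Finset.card_nbij' (fun u => 2 * t * u + (b - a - t))
    (fun s => (s - (b - a - t)) / (2 * t)) ?_ ?_ ?_ ?_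
  · intro u hu
    simp only [Finset.coe_filter, Finset.mem_univ, true_and, Set.mem_ofPred_eq] at hu
    obtain ⟨h0, h1, hu⟩ := hu
    rw [div_add_div_one_sub_eq_iff h0 h1] at hu
    simp only [Set.coe_toFinset, Set.mem_ofPred_eq]
    linear_combination 4 * t * hu
  · intro s hs
    simp only [Set.coe_toFinset, Set.mem_ofPred_eq] at hs
    simp only [Finset.coe_filter, Finset.mem_univ, true_and, Set.mem_ofPred_eq]
    have h4 : (4 : F) ≠ 0 := by
      have : (4 : F) = 2 * 2 := by norm_num
      rw [this]
      exact mul_ne_zero h2' h2'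
    have hu : s = 2 * t * ((s - (b - a - t)) / (2 * t)) + (b - a - t) := by field_simp; ring
    generalize (s - (b - a - t)) / (2 * t) = u at hu
    have hq : t * u ^ 2 + (b - a - t) * u + a = 0 := by
      refine mul_left_cancel₀ (mul_ne_zero h4 ht) ?_
      rw [hu] at hs
      linear_combination hs
    have h0 : u ≠ 0 := by
      rintro rfl
      exact ha (by linear_combination hq)
    have h1 : u ≠ 1 := by
      rintro rfl
      exact hb (by linear_combination hq)
    exact ⟨h0, h1, (div_add_div_one_sub_eq_iff h0 h1).2 hq⟩
  · intro u _
    field_simp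
    ring
  · intro s _
    field_simp
    ring

theorem fiberCount_zero_le {F : Type*} [Field F] [Fintype F] [DecidableEq F] {a : F} (b : F)
    (ha : a ≠ 0) : fiberCount a b 0 ≤ 1 := by
  rw [fiberCount, Finset.card_le_one]
  intro u hu v hv
  simp only [Finset.mem_filter, Finset.mem_univ, true_and] at hu hv
  have h1 := (div_add_div_one_sub_eq_iff hu.1 hu.2.1).1 hu.2.2
  have h2 := (div_add_div_one_sub_eq_iff hv.1 hv.2.1).1 hv.2.2
  have hba : b - a ≠ 0 := by
    intro h
    exact ha (by linear_combination h1 - u * h)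
  exact mul_left_cancel₀ hba (by linear_combination h1 - h2)

theorem sum_fiberCount {F : Type*} [Field F] [Fintype F] [DecidableEq F] (a b : F) :
    ∑ t, fiberCount a b t + 2 = Fintype.card F := by
  have h := Finset.card_eq_sum_card_fiberwise (f := fun u : F => a / u + b / (1 - u))
    (s := Finset.univ.filter fun u : F => u ≠ 0 ∧ u ≠ 1) (t := Finset.univ)
    (by intro x _; simp)
  have h2 : (Finset.univ.filter fun u : F => u ≠ 0 ∧ u ≠ 1).card + 2 = Fintype.card F := by
    have : (Finset.univ.filter fun u : F => u ≠ 0 ∧ u ≠ 1) = ({0, 1} : Finset F)ᶜ := by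
      ext u; simp
    rw [this, ← Finset.card_compl_add_card ({0, 1} : Finset F),
      Finset.card_pair zero_ne_one]
  rw [← h2, h]
  simp only [fiberCount, Finset.filter_filter, and_assoc]

theorem abs_sum_fiberCount_mul_sub_le {p : ℕ} [Fact p.Prime] (hp : 64 ≤ p) {a b c d : ZMod p}
    (ha : a ≠ 0) (hb : b ≠ 0) (hc : c ≠ 0) (hd : d ≠ 0)
    (h : ¬ ((a = c ∧ b = d) ∨ (a = d ∧ b = c))) :
    |∑ t, (fiberCount a b t * fiberCount c d t : ℤ) - p| ≤ 13 * (Nat.sqrt p : ℤ) + 46 := by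
  have hchar : ringChar (ZMod p) ≠ 2 := by rw [ZMod.ringChar_zmod_n]; omega
  have h2 : (2 : ZMod p) ≠ 0 := Ring.two_ne_zero hchar
  have hW := abs_sum_quadraticChar_quartic_le hp ((monic_discPoly a b).mul (monic_discPoly c d))
    (not_isSquare_discPoly_mul h2 ha hb hc hd h) (by
      rw [(monic_discPoly a b).natDegree_mul (monic_discPoly c d), natDegree_discPoly,
        natDegree_discPoly])
  have h1 := sum_fiberCount a b
  have h3 := sum_fiberCount c d
  rw [ZMod.card] at h1 h3
  have hA := Finset.add_sum_erase Finset.univ (fun t => (fiberCount a b t : ℤ))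
    (Finset.mem_univ 0)
  have hB := Finset.add_sum_erase Finset.univ (fun t => (fiberCount c d t : ℤ))
    (Finset.mem_univ 0)
  have hAB := Finset.add_sum_erase Finset.univ
    (fun t => (fiberCount a b t * fiberCount c d t : ℤ)) (Finset.mem_univ 0)
  have hX := Finset.add_sum_erase Finset.univ
    (fun t => quadraticChar (ZMod p) ((discPoly a b * discPoly c d).eval t)) (Finset.mem_univ 0)
  have hcard : ∑ t ∈ Finset.univ.erase (0 : ZMod p), (1 : ℤ) = p - 1 := by
    rw [Finset.sum_const, Finset.card_erase_of_mem (Finset.mem_univ _), Finset.card_univ,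
      ZMod.card, nsmul_eq_mul, mul_one, Nat.cast_sub (by omega), Nat.cast_one]
  have hmain : ∑ t ∈ Finset.univ.erase (0 : ZMod p), (fiberCount a b t * fiberCount c d t : ℤ) =
      ∑ t ∈ Finset.univ.erase (0 : ZMod p), (fiberCount a b t : ℤ) +
      ∑ t ∈ Finset.univ.erase (0 : ZMod p), (fiberCount c d t : ℤ) -
      ∑ t ∈ Finset.univ.erase (0 : ZMod p), (1 : ℤ) +
      ∑ t ∈ Finset.univ.erase (0 : ZMod p),
        quadraticChar (ZMod p) ((discPoly a b * discPoly c d).eval t) := by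
    rw [← Finset.sum_add_distrib, ← Finset.sum_sub_distrib, ← Finset.sum_add_distrib]
    refine Finset.sum_congr rfl fun t ht => ?_
    have ht0 := Finset.ne_of_mem_erase ht
    rw [fiberCount_eq hchar ha hb ht0, fiberCount_eq hchar hc hd ht0, eval_mul, map_mul]
    ring
  have hχ : |quadraticChar (ZMod p) ((discPoly a b * discPoly c d).eval 0)| ≤ 1 := by
    rcases eq_or_ne ((discPoly a b * discPoly c d).eval 0) 0 with h0 | h0
    · simp [h0]
    · rcases quadraticChar_dichotomy h0 with h | h <;> rw [h] <;> simp
  have hz1 := fiberCount_zero_le b ha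
  have hz2 := fiberCount_zero_le d hc
  have hz3 : fiberCount a b 0 * fiberCount c d 0 ≤ 1 := by nlinarith
  zify at h1 h3 hz1 hz2 hz3
  have hz4 : (0 : ℤ) ≤ fiberCount a b 0 * fiberCount c d 0 := by positivity
  rw [abs_le] at hW hχ ⊢
  constructor <;> linarith

/-- The nonzero elements of a finite field. -/
def nonzeroElems (F : Type*) [Field F] [Fintype F] [DecidableEq F] : Finset F :=
  Finset.univ.filter fun x => x ≠ 0

/-- Quadruples of nonzero elements with sum zero. -/
def zeroSumQuads (F : Type*) [Field F] [Fintype F] [DecidableEq F] : Finset (F × F × F × F) :=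
  (nonzeroElems F ×ˢ nonzeroElems F ×ˢ nonzeroElems F ×ˢ nonzeroElems F).filter
    fun q => q.1 + q.2.1 + q.2.2.1 + q.2.2.2 = 0

/-- The form `a / x + b / y + c / z + d / w`. -/
def invForm {F : Type*} [Field F] (a b c d : F) (q : F × F × F × F) : F :=
  a / q.1 + b / q.2.1 + c / q.2.2.1 + d / q.2.2.2

section Counting

variable {F : Type*} [Field F] [Fintype F] [DecidableEq F]

theorem mem_nonzeroElems {x : F} : x ∈ nonzeroElems F ↔ x ≠ 0 := by
  simp [nonzeroElems]

theorem card_nonzeroElems_add_one : (nonzeroElems F).card + 1 = Fintype.card F := by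
  rw [nonzeroElems, Finset.filter_ne', Finset.card_erase_add_one (Finset.mem_univ _),
    Finset.card_univ]

theorem mem_zeroSumQuads {x y z w : F} : (x, y, z, w) ∈ zeroSumQuads F ↔
    x ≠ 0 ∧ y ≠ 0 ∧ z ≠ 0 ∧ w ≠ 0 ∧ x + y + z + w = 0 := by
  simp [zeroSumQuads, mem_nonzeroElems, and_assoc]

theorem card_zeroSumQuads_bounds : (zeroSumQuads F).card ≤ (nonzeroElems F).card ^ 3 ∧
    (nonzeroElems F).card ^ 3 ≤ (zeroSumQuads F).card + (nonzeroElems F).card ^ 2 := by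
  set S := nonzeroElems F with hS
  set W := S ×ˢ S ×ˢ S with hW
  have hWc : W.card = S.card ^ 3 := by
    rw [hW, Finset.card_product, Finset.card_product]; ring
  have h1 : (zeroSumQuads F).card = (W.filter fun q => ¬ q.1 + q.2.1 + q.2.2 = 0).card := by
    refine Finset.card_nbij' (fun q => (q.1, q.2.1, q.2.2.1))
      (fun q => (q.1, q.2.1, q.2.2, -(q.1 + q.2.1 + q.2.2))) ?_ ?_ ?_ ?_
    · rintro ⟨x, y, z, w⟩ hq
      obtain ⟨hx, hy, hz, hw, h⟩ := mem_zeroSumQuads.1 (Finset.mem_coe.1 hq)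
      simp only [hW, hS, Finset.coe_filter, Finset.mem_product, mem_nonzeroElems,
        Set.mem_ofPred_eq]
      exact ⟨⟨hx, hy, hz⟩, fun h0 => hw (by linear_combination h - h0)⟩
    · rintro ⟨x, y, z⟩ hq
      simp only [hW, hS, Finset.coe_filter, Finset.mem_product, mem_nonzeroElems,
        Set.mem_ofPred_eq] at hq
      rw [Finset.mem_coe, mem_zeroSumQuads]
      exact ⟨hq.1.1, hq.1.2.1, hq.1.2.2, neg_ne_zero.2 hq.2, by ring⟩
    · rintro ⟨x, y, z, w⟩ hq
      obtain ⟨hx, hy, hz, hw, h⟩ := mem_zeroSumQuads.1 (Finset.mem_coe.1 hq)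
      simp only [Prod.mk.injEq, true_and]
      linear_combination -h
    · rintro ⟨x, y, z⟩ _
      rfl
  have h2 : (W.filter fun q => q.1 + q.2.1 + q.2.2 = 0).card ≤ S.card ^ 2 := by
    rw [sq, ← Finset.card_product]
    refine Finset.card_le_card_of_injOn (fun q => (q.1, q.2.1)) ?_ ?_
    · rintro ⟨x, y, z⟩ hq
      simp only [hW, Finset.coe_filter, Finset.mem_product, Set.mem_ofPred_eq] at hq
      simpa using ⟨hq.1.1, hq.1.2.1⟩
    · rintro ⟨x, y, z⟩ hq ⟨x', y', z'⟩ hq' h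
      simp only [Finset.coe_filter, Set.mem_ofPred_eq] at hq hq'
      simp only [Prod.mk.injEq] at h ⊢
      obtain ⟨rfl, rfl⟩ := h
      exact ⟨rfl, rfl, by linear_combination hq.2 - hq'.2⟩
  have h3 := Finset.card_filter_add_card_filter_not (s := W) (fun q => q.1 + q.2.1 + q.2.2 = 0)
  rw [h1, ← hWc]
  omega

theorem card_filter_fiber_eq (a b c d : F) :
    ((Finset.univ : Finset (F × F)).filter fun q => (q.1 ≠ 0 ∧ q.1 ≠ 1) ∧ (q.2 ≠ 0 ∧ q.2 ≠ 1) ∧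
      a / q.1 + b / (1 - q.1) = c / q.2 + d / (1 - q.2)).card =
    ∑ t, fiberCount a b t * fiberCount c d t := by
  rw [Finset.card_eq_sum_card_fiberwise (f := fun q : F × F => a / q.1 + b / (1 - q.1))
    (t := Finset.univ) (by intro x _; simp)]
  refine Finset.sum_congr rfl fun t _ => ?_
  rw [fiberCount, fiberCount, ← Finset.card_product]
  congr 1
  ext ⟨u, v⟩
  simp only [Finset.mem_filter, Finset.mem_univ, true_and, Finset.mem_product]
  constructor
  · rintro ⟨⟨⟨h1, h2⟩, ⟨h3, h4⟩, h⟩, rfl⟩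
    exact ⟨⟨h1, h2, rfl⟩, h3, h4, h.symm⟩
  · rintro ⟨⟨h1, h2, rfl⟩, h3, h4, h⟩
    exact ⟨⟨⟨h1, h2⟩, ⟨h3, h4⟩, h.symm⟩, rfl⟩

theorem card_zeroSumQuads_invForm_eq_zero_of_ne (a b c d : F) :
    ((zeroSumQuads F).filter fun q => invForm a b c d q = 0 ∧ ¬ q.1 + q.2.1 = 0).card =
      (nonzeroElems F).card * ∑ t, fiberCount a b t * fiberCount c d t := by
  rw [← card_filter_fiber_eq, ← Finset.card_product]
  refine Finset.card_nbij'
    (fun q => (q.1 + q.2.1, q.1 / (q.1 + q.2.1), -q.2.2.1 / (q.1 + q.2.1)))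
    (fun q => (q.1 * q.2.1, q.1 * (1 - q.2.1), -(q.1 * q.2.2), -(q.1 * (1 - q.2.2)))) ?_ ?_ ?_ ?_
  · rintro ⟨x, y, z, w⟩ hq
    rw [Finset.mem_coe, Finset.mem_filter, mem_zeroSumQuads] at hq
    simp only [invForm] at hq
    obtain ⟨⟨hx, hy, hz, hw, h⟩, hQ, hs⟩ := hq
    simp only [Finset.mem_coe, Finset.mem_product, mem_nonzeroElems, Finset.mem_filter,
      Finset.mem_univ, true_and]
    have e1 : 1 - x / (x + y) = y / (x + y) := by field_simp; ring
    have e2 : 1 - -z / (x + y) = -w / (x + y) := by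
      field_simp; linear_combination h
    refine ⟨hs, ⟨div_ne_zero hx hs, ?_⟩, ⟨div_ne_zero (neg_ne_zero.2 hz) hs, ?_⟩, ?_⟩
    · rw [← sub_ne_zero, ← neg_ne_zero, neg_sub, e1]
      exact div_ne_zero hy hs
    · rw [← sub_ne_zero, ← neg_ne_zero, neg_sub, e2]
      exact div_ne_zero (neg_ne_zero.2 hw) hs
    · rw [e1, e2]
      simp only [div_div_eq_mul_div, div_neg]
      linear_combination (x + y) * hQ
  · rintro ⟨s, u, v⟩ hq
    simp only [Finset.mem_coe, Finset.mem_product, mem_nonzeroElems, Finset.mem_filter,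
      Finset.mem_univ, true_and] at hq
    obtain ⟨hs, ⟨hu0, hu1⟩, ⟨hv0, hv1⟩, h⟩ := hq
    have hu1' : 1 - u ≠ 0 := sub_ne_zero.2 hu1.symm
    have hv1' : 1 - v ≠ 0 := sub_ne_zero.2 hv1.symm
    rw [Finset.mem_coe, Finset.mem_filter, mem_zeroSumQuads]
    simp only [invForm]
    refine ⟨⟨mul_ne_zero hs hu0, mul_ne_zero hs hu1', neg_ne_zero.2 (mul_ne_zero hs hv0),
      neg_ne_zero.2 (mul_ne_zero hs hv1'), by ring⟩, ?_, ?_⟩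
    · have : a / (s * u) + b / (s * (1 - u)) + c / (-(s * v)) + d / (-(s * (1 - v))) =
          s⁻¹ * (a / u + b / (1 - u) - (c / v + d / (1 - v))) := by
        field_simp
        ring
      rw [this, h, sub_self, mul_zero]
    · intro h0
      exact hs (by linear_combination h0)
  · rintro ⟨x, y, z, w⟩ hq
    simp only [Finset.coe_filter, mem_zeroSumQuads, Set.mem_ofPred_eq] at hq
    obtain ⟨⟨hx, hy, hz, hw, h⟩, hQ, hs⟩ := hq
    simp only [Prod.mk.injEq]
    refine ⟨?_, ?_, ?_, ?_⟩
    · field_simp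
    · field_simp; ring
    · field_simp
    · field_simp; linear_combination -h
  · rintro ⟨s, u, v⟩ hq
    simp only [Finset.mem_coe, Finset.mem_product, mem_nonzeroElems] at hq
    have hs := hq.1
    have e : s * u + s * (1 - u) = s := by ring
    simp only [Prod.mk.injEq]
    rw [e]
    refine ⟨rfl, ?_, ?_⟩ <;> field_simp

theorem card_zeroSumQuads_invForm_eq_zero_of_eq_le {a b c d : F} (h : ¬ (a = b ∧ c = d)) :
    ((zeroSumQuads F).filter fun q => invForm a b c d q = 0 ∧ q.1 + q.2.1 = 0).card ≤
      (nonzeroElems F).card := by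
  refine Finset.card_le_card_of_injOn (fun q => q.2.2.1) ?_ ?_
  · rintro ⟨x, y, z, w⟩ hq
    simp only [Finset.coe_filter, mem_zeroSumQuads, Set.mem_ofPred_eq] at hq
    exact Finset.mem_coe.2 (mem_nonzeroElems.2 hq.1.2.2.1)
  · have key (x y z w : F) (hx : x ≠ 0) (hz : z ≠ 0) (hs : x + y + z + w = 0)
        (hQ : invForm a b c d (x, y, z, w) = 0) (hxy : x + y = 0) :
        y = -x ∧ w = -z ∧ (a - b) * z + (c - d) * x = 0 := by
      obtain rfl : y = -x := by linear_combination hxy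
      obtain rfl : w = -z := by linear_combination hs
      refine ⟨rfl, rfl, ?_⟩
      simp only [invForm] at hQ
      field_simp at hQ
      linear_combination hQ
    rintro ⟨x, y, z, w⟩ hq ⟨x', y', z', w'⟩ hq' hzz
    simp only [Finset.coe_filter, mem_zeroSumQuads, Set.mem_ofPred_eq] at hq hq' hzz
    obtain ⟨⟨hx, -, hz, -, hs⟩, hQ, hxy⟩ := hq
    obtain ⟨⟨hx', -, hz', -, hs'⟩, hQ', hxy'⟩ := hq'
    subst hzz
    obtain ⟨rfl, rfl, h1⟩ := key x y z w hx hz hs hQ hxy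
    obtain ⟨rfl, rfl, h2⟩ := key x' y' z w' hx' hz hs' hQ' hxy'
    have hcd : c - d ≠ 0 := by
      intro h0
      rw [h0, zero_mul, add_zero] at h1
      exact h ⟨sub_eq_zero.1 ((mul_eq_zero.1 h1).resolve_right hz), sub_eq_zero.1 h0⟩
    obtain rfl : x = x' := mul_left_cancel₀ hcd (by linear_combination h1 - h2)
    rfl

end Counting

section CharacterSums

variable {F : Type*} [Field F] [Fintype F] [DecidableEq F]

theorem sum_zeroSumQuads_smul (ψ : AddChar F ℂ) (a b c d : F) {l : F} (hl : l ≠ 0) :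
    ∑ q ∈ zeroSumQuads F, ψ (l * invForm a b c d q) =
      ∑ q ∈ zeroSumQuads F, ψ (invForm a b c d q) := by
  have key (m : F) (hm : m ≠ 0) (q : F × F × F × F) (hq : q ∈ zeroSumQuads F) :
      (m * q.1, m * q.2.1, m * q.2.2.1, m * q.2.2.2) ∈ zeroSumQuads F := by
    obtain ⟨x, y, z, w⟩ := q
    obtain ⟨hx, hy, hz, hw, h⟩ := mem_zeroSumQuads.1 hq
    exact mem_zeroSumQuads.2 ⟨mul_ne_zero hm hx, mul_ne_zero hm hy, mul_ne_zero hm hz,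
      mul_ne_zero hm hw, by linear_combination m * h⟩
  refine Finset.sum_nbij' (fun q => (l⁻¹ * q.1, l⁻¹ * q.2.1, l⁻¹ * q.2.2.1, l⁻¹ * q.2.2.2))
    (fun q => (l * q.1, l * q.2.1, l * q.2.2.1, l * q.2.2.2)) (key _ (inv_ne_zero hl))
    (key l hl) ?_ ?_ ?_
  · rintro ⟨x, y, z, w⟩ _
    simp [hl]
  · rintro ⟨x, y, z, w⟩ _
    simp [hl]
  · rintro ⟨x, y, z, w⟩ hq
    obtain ⟨hx, hy, hz, hw, h⟩ := mem_zeroSumQuads.1 hq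
    congr 1
    simp only [invForm]
    field_simp

theorem card_mul_sum_zeroSumQuads {ψ : AddChar F ℂ} (hψ : ψ.IsPrimitive) (a b c d : F) :
    ((nonzeroElems F).card : ℂ) * ∑ q ∈ zeroSumQuads F, ψ (invForm a b c d q) =
      Fintype.card F * ((zeroSumQuads F).filter fun q => invForm a b c d q = 0).card -
        (zeroSumQuads F).card := by
  have h1 : ∑ l, ∑ q ∈ zeroSumQuads F, ψ (l * invForm a b c d q) =
      Fintype.card F * ((zeroSumQuads F).filter fun q => invForm a b c d q = 0).card := by
    rw [Finset.sum_comm]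
    simp_rw [AddChar.sum_mulShift _ hψ]
    rw [← Finset.sum_filter_add_sum_filter_not (zeroSumQuads F)
      (fun q => invForm a b c d q = 0)]
    rw [Finset.sum_congr rfl (g := fun _ => (Fintype.card F : ℂ))
      (fun q hq => by simp [(Finset.mem_filter.1 hq).2]),
      Finset.sum_eq_zero (s := Finset.filter (fun q => ¬ _) _)
      (fun q hq => by simp [(Finset.mem_filter.1 hq).2])]
    simp [mul_comm]
  rw [← h1, ← Finset.add_sum_erase _ _ (Finset.mem_univ (0 : F))]
  rw [Finset.sum_congr rfl (s₁ := Finset.univ.erase (0 : F))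
    (fun l hl => sum_zeroSumQuads_smul ψ a b c d (Finset.ne_of_mem_erase hl))]
  have h2 : (Finset.univ.erase (0 : F)).card = (nonzeroElems F).card := by
    rw [nonzeroElems, Finset.filter_ne']
  simp [h2]

theorem sum_prod_kloosterman_eq {ψ : AddChar F ℂ} (hψ : ψ.IsPrimitive) (a b c d : F) :
    ∑ h, (∑ x ∈ nonzeroElems F, ψ (h * x + a * x⁻¹)) *
        (∑ x ∈ nonzeroElems F, ψ (h * x + b * x⁻¹)) *
        (∑ x ∈ nonzeroElems F, ψ (h * x + c * x⁻¹)) *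
        (∑ x ∈ nonzeroElems F, ψ (h * x + d * x⁻¹)) =
      Fintype.card F * ∑ q ∈ zeroSumQuads F, ψ (invForm a b c d q) := by
  set S := nonzeroElems F
  have h1 (h : F) : (∑ x ∈ S, ψ (h * x + a * x⁻¹)) * (∑ x ∈ S, ψ (h * x + b * x⁻¹)) *
        (∑ x ∈ S, ψ (h * x + c * x⁻¹)) * (∑ x ∈ S, ψ (h * x + d * x⁻¹)) =
      ∑ q ∈ S ×ˢ S ×ˢ S ×ˢ S,
        ψ (h * (q.1 + q.2.1 + q.2.2.1 + q.2.2.2)) * ψ (invForm a b c d q) := by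
    rw [mul_assoc, mul_assoc, Finset.sum_product, Finset.sum_mul]
    refine Finset.sum_congr rfl fun x _ => ?_
    rw [Finset.sum_product, Finset.sum_mul, Finset.mul_sum]
    refine Finset.sum_congr rfl fun y _ => ?_
    rw [Finset.sum_product, Finset.sum_mul, Finset.mul_sum, Finset.mul_sum]
    refine Finset.sum_congr rfl fun z _ => ?_
    rw [Finset.mul_sum, Finset.mul_sum, Finset.mul_sum]
    refine Finset.sum_congr rfl fun w _ => ?_
    simp only [← AddChar.map_add_eq_mul, invForm]
    congr 1
    ring
  simp_rw [h1]
  rw [Finset.sum_comm, zeroSumQuads, Finset.sum_filter, Finset.mul_sum]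
  refine Finset.sum_congr rfl fun q _ => ?_
  rw [← Finset.sum_mul, AddChar.sum_mulShift _ hψ]
  split_ifs <;> simp

end CharacterSums

theorem eInt_eq_stdAddChar (p : ℕ) [NeZero p] (x : ℤ) :
    eInt p x = ZMod.stdAddChar (x : ZMod p) := by
  rw [eInt, ZMod.stdAddChar_coe]

theorem sum_range_eq_sum_zmod (p : ℕ) [NeZero p] (f : ZMod p → ℂ) :
    ∑ h ∈ Finset.range p, f (h : ZMod p) = ∑ h, f h := by
  refine Finset.sum_nbij' (fun h => (h : ZMod p)) ZMod.val ?_ ?_ ?_ ?_ ?_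
  · intro h _; exact Finset.mem_univ _
  · intro h _; exact Finset.mem_range.2 (ZMod.val_lt h)
  · intro h hh; exact ZMod.val_cast_of_lt (Finset.mem_range.1 hh)
  · intro h _; exact ZMod.natCast_zmod_val h
  · intro h _; rfl

theorem Kloos_eq_sum {p : ℕ} [Fact p.Prime] (a b : ℤ) : Kloos p a b =
    ∑ x ∈ nonzeroElems (ZMod p), ZMod.stdAddChar ((a : ZMod p) * x + (b : ZMod p) * x⁻¹) := by
  rw [Kloos, nonzeroElems, Finset.sum_filter, Finset.sum_filter, ← sum_range_eq_sum_zmod p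
    (fun x => if x ≠ 0 then ZMod.stdAddChar ((a : ZMod p) * x + (b : ZMod p) * x⁻¹) else 0)]
  refine Finset.sum_congr rfl fun x _ => ?_
  have hx : Nat.Coprime x p ↔ (x : ZMod p) ≠ 0 := by
    rw [Ne, ZMod.natCast_eq_zero_iff, Nat.coprime_comm, (Fact.out : p.Prime).coprime_iff_not_dvd]
  simp only [hx, eInt_eq_stdAddChar, invMod]
  push_cast
  rw [ZMod.natCast_zmod_val]

theorem Gquad_eq {p : ℕ} [Fact p.Prime] (a b c d : ℤ) : Gquad p a b c d =
    p * ∑ q ∈ zeroSumQuads (ZMod p),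
      ZMod.stdAddChar (invForm (a : ZMod p)⁻¹ (b : ZMod p)⁻¹ (c : ZMod p)⁻¹ (d : ZMod p)⁻¹ q) := by
  have h := sum_prod_kloosterman_eq (ZMod.isPrimitive_stdAddChar p)
    (a : ZMod p)⁻¹ (b : ZMod p)⁻¹ (c : ZMod p)⁻¹ (d : ZMod p)⁻¹
  rw [ZMod.card] at h
  rw [← h, ← sum_range_eq_sum_zmod p, Gquad]
  refine Finset.sum_congr rfl fun x _ => ?_
  simp only [Kloos_eq_sum, invMod, Int.cast_natCast, ZMod.natCast_zmod_val]

theorem norm_Gquad_mul_eq {p : ℕ} [Fact p.Prime] (a b c d : ℤ) :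
    ‖Gquad p a b c d‖ * (p - 1) = p * |(p : ℝ) * ((zeroSumQuads (ZMod p)).filter fun q =>
      invForm (a : ZMod p)⁻¹ (b : ZMod p)⁻¹ (c : ZMod p)⁻¹ (d : ZMod p)⁻¹ q = 0).card -
        (zeroSumQuads (ZMod p)).card| := by
  have h := card_mul_sum_zeroSumQuads (ZMod.isPrimitive_stdAddChar p)
    (a : ZMod p)⁻¹ (b : ZMod p)⁻¹ (c : ZMod p)⁻¹ (d : ZMod p)⁻¹
  have hn := card_nonzeroElems_add_one (F := ZMod p)
  rw [ZMod.card] at h hn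
  have hn' : ((nonzeroElems (ZMod p)).card : ℝ) = p - 1 :=
    eq_sub_of_add_eq (by exact_mod_cast hn)
  have h' := congrArg norm h
  rw [norm_mul, Complex.norm_natCast, hn'] at h'
  rw [Gquad_eq, norm_mul, Complex.norm_natCast, mul_assoc, mul_comm ‖_‖, h', ← Real.norm_eq_abs,
    ← Complex.norm_real]
  push_cast
  rfl

theorem norm_Gquad_le {p : ℕ} [Fact p.Prime] (a b c d : ℤ) :
    ‖Gquad p a b c d‖ ≤ (p : ℝ) ^ 5 := by
  have h := norm_Gquad_mul_eq (p := p) a b c d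
  have hn := card_nonzeroElems_add_one (F := ZMod p)
  rw [ZMod.card] at hn
  have hZ := (card_zeroSumQuads_bounds (F := ZMod p)).1
  have hN : ((zeroSumQuads (ZMod p)).filter fun q => invForm (a : ZMod p)⁻¹ (b : ZMod p)⁻¹
    (c : ZMod p)⁻¹ (d : ZMod p)⁻¹ q = 0).card ≤ _ := Finset.card_filter_le _ _
  generalize ((zeroSumQuads (ZMod p)).filter fun q => invForm (a : ZMod p)⁻¹ (b : ZMod p)⁻¹
    (c : ZMod p)⁻¹ (d : ZMod p)⁻¹ q = 0).card = N at *
  generalize (zeroSumQuads (ZMod p)).card = Z at *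
  generalize (nonzeroElems (ZMod p)).card = n at *
  have hp2 := (Fact.out : p.Prime).two_le
  have hpn : (p : ℝ) - 1 = n := by rw [← hn]; push_cast; ring
  have hn1 : (1 : ℝ) ≤ n := by exact_mod_cast (by omega : 1 ≤ n)
  have hZ' : (Z : ℝ) ≤ (n : ℝ) ^ 3 := by exact_mod_cast hZ
  have hN' : (N : ℝ) ≤ Z := by exact_mod_cast hN
  have hp0 : (1 : ℝ) ≤ p := by linarith
  have hN0 : (0 : ℝ) ≤ N := Nat.cast_nonneg N
  have hZ0 : (0 : ℝ) ≤ Z := Nat.cast_nonneg Z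
  have habs : |(p : ℝ) * N - Z| ≤ p * n ^ 3 := by
    rw [abs_le]
    constructor <;> nlinarith
  rw [hpn] at h
  have h1 : ‖Gquad p a b c d‖ * n ≤ (p ^ 2 * n ^ 2) * n := by
    rw [h]; nlinarith
  have h2 := le_of_mul_le_mul_right h1 (by linarith)
  have h3 : (n : ℝ) ^ 2 ≤ p ^ 3 := by
    calc (n : ℝ) ^ 2 ≤ p ^ 2 := pow_le_pow_left₀ (by linarith) (by linarith) 2
      _ ≤ p ^ 3 := pow_le_pow_right₀ hp0 (by norm_num)
  calc ‖Gquad p a b c d‖ ≤ p ^ 2 * n ^ 2 := h2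
    _ ≤ p ^ 2 * p ^ 3 := by gcongr
    _ = (p : ℝ) ^ 5 := by ring

theorem norm_Gquad_le_of_large {p : ℕ} [Fact p.Prime] (hp : 64 ≤ p) (b : Fin 4 → ℤ)
    (hb : ∀ i, (b i : ZMod p) ≠ 0) (hne : ∃ i, ∀ j, j ≠ i → (b i : ZMod p) ≠ b j) :
    ‖Gquad p (b 0) (b 1) (b 2) (b 3)‖ ≤ (p : ℝ) ^ 2 * (13 * Real.sqrt p + 50) := by
  have hinj (i j : Fin 4) : (b i : ZMod p)⁻¹ = (b j : ZMod p)⁻¹ ↔ (b i : ZMod p) = b j :=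
    inv_inj
  have hdiag : ¬ ((b 0 : ZMod p)⁻¹ = (b 1 : ZMod p)⁻¹ ∧ (b 2 : ZMod p)⁻¹ = (b 3 : ZMod p)⁻¹) := by
    simp only [hinj]
    rintro ⟨h1, h2⟩
    obtain ⟨i, hi⟩ := hne
    fin_cases i
    · exact hi 1 (by decide) h1
    · exact hi 0 (by decide) h1.symm
    · exact hi 3 (by decide) h2
    · exact hi 2 (by decide) h2.symm
  have hcross : ¬ (((b 0 : ZMod p)⁻¹ = (b 2 : ZMod p)⁻¹ ∧ (b 1 : ZMod p)⁻¹ = (b 3 : ZMod p)⁻¹) ∨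
      ((b 0 : ZMod p)⁻¹ = (b 3 : ZMod p)⁻¹ ∧ (b 1 : ZMod p)⁻¹ = (b 2 : ZMod p)⁻¹)) := by
    simp only [hinj]
    obtain ⟨i, hi⟩ := hne
    rintro (⟨h1, h2⟩ | ⟨h1, h2⟩) <;> fin_cases i
    · exact hi 2 (by decide) h1
    · exact hi 3 (by decide) h2
    · exact hi 0 (by decide) h1.symm
    · exact hi 1 (by decide) h2.symm
    · exact hi 3 (by decide) h1
    · exact hi 2 (by decide) h2
    · exact hi 1 (by decide) h2.symm
    · exact hi 0 (by decide) h1.symm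
  have hW := abs_sum_fiberCount_mul_sub_le hp (inv_ne_zero (hb 0)) (inv_ne_zero (hb 1))
    (inv_ne_zero (hb 2)) (inv_ne_zero (hb 3)) hcross
  have hN0 := card_zeroSumQuads_invForm_eq_zero_of_eq_le hdiag
  have hN1 := card_zeroSumQuads_invForm_eq_zero_of_ne (b 0 : ZMod p)⁻¹ (b 1 : ZMod p)⁻¹
    (b 2 : ZMod p)⁻¹ (b 3 : ZMod p)⁻¹
  have hN := Finset.card_filter_add_card_filter_not
    (s := (zeroSumQuads (ZMod p)).filter fun q => invForm (b 0 : ZMod p)⁻¹ (b 1 : ZMod p)⁻¹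
      (b 2 : ZMod p)⁻¹ (b 3 : ZMod p)⁻¹ q = 0) (fun q => q.1 + q.2.1 = 0)
  rw [Finset.filter_filter, Finset.filter_filter, hN1] at hN
  have h := norm_Gquad_mul_eq (p := p) (b 0) (b 1) (b 2) (b 3)
  rw [← hN] at h
  have hn := card_nonzeroElems_add_one (F := ZMod p)
  rw [ZMod.card] at hn
  obtain ⟨hZ1, hZ2⟩ := card_zeroSumQuads_bounds (F := ZMod p)
  have hW' : |((∑ t, fiberCount (b 0 : ZMod p)⁻¹ (b 1 : ZMod p)⁻¹ t *
      fiberCount (b 2 : ZMod p)⁻¹ (b 3 : ZMod p)⁻¹ t : ℕ) : ℝ) - p| ≤ 13 * Nat.sqrt p + 46 := by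
    exact_mod_cast hW
  clear hW hN hN1
  generalize (∑ t, fiberCount (b 0 : ZMod p)⁻¹ (b 1 : ZMod p)⁻¹ t *
      fiberCount (b 2 : ZMod p)⁻¹ (b 3 : ZMod p)⁻¹ t) = R at *
  generalize ((zeroSumQuads (ZMod p)).filter fun q => invForm (b 0 : ZMod p)⁻¹ (b 1 : ZMod p)⁻¹
    (b 2 : ZMod p)⁻¹ (b 3 : ZMod p)⁻¹ q = 0 ∧ q.1 + q.2.1 = 0).card = N at *
  generalize (zeroSumQuads (ZMod p)).card = Z at *
  generalize (nonzeroElems (ZMod p)).card = n at *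
  have hpn : (p : ℝ) - 1 = n := by rw [← hn]; push_cast; ring
  have hn1 : (1 : ℝ) ≤ n := by exact_mod_cast (by omega : 1 ≤ n)
  have hp0 : (p : ℝ) = n + 1 := by linarith
  have hZ1' : (Z : ℝ) ≤ (n : ℝ) ^ 3 := by exact_mod_cast hZ1
  have hZ2' : (n : ℝ) ^ 3 ≤ Z + (n : ℝ) ^ 2 := by exact_mod_cast hZ2
  have hN' : (N : ℝ) ≤ n := by exact_mod_cast hN0
  have hN0' : (0 : ℝ) ≤ N := Nat.cast_nonneg N
  have hsqrt : (Nat.sqrt p : ℝ) ≤ Real.sqrt p := Real.nat_sqrt_le_real_sqrt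
  set E := 13 * Real.sqrt p + 46 with hE
  have hWE : |(R : ℝ) - p| ≤ E := hW'.trans (by linarith)
  have habs : |(p : ℝ) * ((N + n * R : ℕ) : ℝ) - Z| ≤ p * n * (E + 4) := by
    have e : (p : ℝ) * ((N + n * R : ℕ) : ℝ) - Z =
        p * n * (R - p) + (p * N + ((n : ℝ) ^ 3 - Z) + n * (2 * p - 1)) := by
      push_cast
      rw [hp0]
      ring
    have h1 : |(p : ℝ) * n * (R - p)| ≤ (p : ℝ) * n * E := by
      rw [abs_mul, abs_of_nonneg (by positivity : (0 : ℝ) ≤ p * n)]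
      gcongr
    have h2 : |(p : ℝ) * N + ((n : ℝ) ^ 3 - Z) + n * (2 * p - 1)| ≤ (p : ℝ) * n * 4 := by
      rw [hp0, abs_le]
      constructor <;> nlinarith [mul_nonneg hN0' (by linarith : (0 : ℝ) ≤ n),
        mul_le_mul_of_nonneg_left hN' (by linarith : (0 : ℝ) ≤ n)]
    rw [e]
    refine (abs_add_le _ _).trans ?_
    linarith
  rw [hpn] at h
  refine le_of_mul_le_mul_right ?_ (by linarith : (0 : ℝ) < n)
  rw [h]
  calc (p : ℝ) * |(p : ℝ) * ((N + n * R : ℕ) : ℝ) - Z| ≤ p * (p * n * (E + 4)) := by gcongr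
    _ = p ^ 2 * (13 * Real.sqrt p + 50) * n := by rw [hE]; ring

/-- There is an absolute constant `C` such that for every prime `p` and integers `b₁,…,b₄`
coprime to `p` such that some `bᵢ` is not congruent mod `p` to any other `b_j`,
one has `|G_p(b₁,b₂,b₃,b₄)| ≤ C p^{5/2}`. -/
theorem Gquad_prime_offdiagonal :
    ∃ C : ℝ, ∀ p : ℕ, p.Prime → ∀ b : Fin 4 → ℤ, (∀ i, Int.gcd (b i) p = 1) →
      (∃ i, ∀ j, j ≠ i → ¬ (b i ≡ b j [ZMOD (p : ℤ)])) →
      ‖Gquad p (b 0) (b 1) (b 2) (b 3)‖ ≤ C * (p : ℝ) ^ ((5 : ℝ) / 2) := by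
  refine ⟨64 ^ 5, fun p hp b hb hne => ?_⟩
  have : Fact p.Prime := ⟨hp⟩
  have hp1 : (1 : ℝ) ≤ p := by exact_mod_cast hp.one_lt.le
  rcases lt_or_ge p 64 with hlt | hge
  · have h1 : (1 : ℝ) ≤ (p : ℝ) ^ ((5 : ℝ) / 2) := Real.one_le_rpow hp1 (by norm_num)
    have h2 : (p : ℝ) ^ 5 ≤ 64 ^ 5 := by
      have : (p : ℝ) ≤ 64 := by exact_mod_cast hlt.le
      gcongr
    exact (norm_Gquad_le _ _ _ _).trans (h2.trans (le_mul_of_one_le_right (by norm_num) h1))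
  · have hpow : (p : ℝ) ^ ((5 : ℝ) / 2) = (p : ℝ) ^ 2 * Real.sqrt p := by
      rw [Real.sqrt_eq_rpow, ← Real.rpow_natCast, ← Real.rpow_add (by linarith)]
      norm_num
    have hs : 1 ≤ Real.sqrt p := Real.one_le_sqrt.2 hp1
    refine (norm_Gquad_le_of_large hge b (fun i h0 => ?_) ?_).trans ?_
    · have h1 := (ZMod.intCast_zmod_eq_zero_iff_dvd (b i) p).1 h0
      have h2 := Int.dvd_gcd h1 dvd_rfl
      rw [hb i] at h2
      exact hp.one_lt.ne' (Nat.dvd_one.1 (by exact_mod_cast h2))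
    · obtain ⟨i, hi⟩ := hne
      exact ⟨i, fun j hj h => hi j hj ((ZMod.intCast_eq_intCast_iff _ _ _).1 h)⟩
    · rw [hpow, mul_left_comm]
      gcongr
      linarith
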